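/- Let A be an n×n sign pattern of cycle form such that D(A_+) contains a directed cycle of length n. If there exist indices i ≠ j with sign(a_{ij} a_{ji}) = − and a_{ii} = +, then A does not require algebraic positivity. -/

import Mathlib

open Matrix

/-- A real square matrix is algebraically positive if some real polynomial
evaluated at it has all entries positive. -/
def AlgPositive {n : ℕ} (M : Matrix (Fin n) (Fin n) ℝ) : Prop :=
  ∃ f : Polynomial ℝ, ∀ i j, 0 < Polynomial.aeval M f i j

/-- `B` belongs to the qualitative class of the sign pattern `A`. -/
def InQClass {n : ℕ} (A : Matrix (Fin n) (Fin n) SignType)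
    (B : Matrix (Fin n) (Fin n) ℝ) : Prop :=
  ∀ i j, SignType.sign (B i j) = A i j

/-- The sign pattern `A` requires algebraic positivity. -/
def RequiresAP {n : ℕ} (A : Matrix (Fin n) (Fin n) SignType) : Prop :=
  ∀ B : Matrix (Fin n) (Fin n) ℝ, InQClass A B → AlgPositive B

/-- An `n × n` sign pattern (indices read modulo `n`) is of cycle form if off-diagonal
entries away from the cycle `(0, 1, …, n-1, 0)` vanish and every edge of the cycle
carries at least one nonzero arc. -/
def CycleForm {n : ℕ} [NeZero n] (A : Matrix (Fin n) (Fin n) SignType) : Prop :=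
  (∀ i j : Fin n, i ≠ j → j ≠ i + 1 → i ≠ j + 1 → A i j = 0) ∧
  (∀ i : Fin n, A i (i + 1) ≠ 0 ∨ A (i + 1) i ≠ 0)

/-- For a cycle-form pattern, `D(A_+)` contains a directed cycle of length `n`. -/
def PlusNCycle {n : ℕ} [NeZero n] (A : Matrix (Fin n) (Fin n) SignType) : Prop :=
  (∀ i : Fin n, A i (i + 1) = 1) ∨ (∀ i : Fin n, A (i + 1) i = 1)

/-- For a cycle-form pattern, `D(A_-)` contains a directed cycle of length `n`. -/
def MinusNCycle {n : ℕ} [NeZero n] (A : Matrix (Fin n) (Fin n) SignType) : Prop :=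
  (∀ i : Fin n, A i (i + 1) = -1) ∨ (∀ i : Fin n, A (i + 1) i = -1)

/-- Simultaneous relabelling of rows and columns preserves requiring algebraic positivity. -/
lemma RequiresAP.submatrix {n : ℕ} {A : Matrix (Fin n) (Fin n) SignType} (h : RequiresAP A)
    (e : Fin n ≃ Fin n) : RequiresAP (A.submatrix e e) := by
  intro B hB
  obtain ⟨f, hf⟩ := h (Matrix.reindexAlgEquiv ℝ ℝ e B) fun i j => by
    simpa [Matrix.coe_reindexAlgEquiv] using hB (e.symm i) (e.symm j)
  refine ⟨f, fun i j => ?_⟩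
  have := hf (e i) (e j)
  rw [Polynomial.aeval_algHom_apply] at this
  simpa using this

/-- Transposition preserves requiring algebraic positivity. -/
lemma RequiresAP.transpose {n : ℕ} {A : Matrix (Fin n) (Fin n) SignType} (h : RequiresAP A) :
    RequiresAP Aᵀ := by
  intro B hB
  obtain ⟨f, hf⟩ := h Bᵀ fun i j => hB j i
  refine ⟨f, fun i j => ?_⟩
  have key : Polynomial.aeval Bᵀ f = (Polynomial.aeval B f)ᵀ := by
    simp [Polynomial.aeval_eq_sum_range, Matrix.transpose_sum]
  simpa [key] using hf j i

lemma mulVec_pos_of_pos {n : ℕ} {P : Matrix (Fin n) (Fin n) ℝ} (hP : ∀ i j, 0 < P i j)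
    {x : Fin n → ℝ} (hx : 0 ≤ x) (hx0 : x ≠ 0) (i : Fin n) : 0 < (P *ᵥ x) i := by
  obtain ⟨j, hj⟩ := Function.ne_iff.1 hx0
  exact Finset.sum_pos' (fun k _ => mul_nonneg (hP i k).le (hx k))
    ⟨j, Finset.mem_univ j, mul_pos (hP i j) (lt_of_le_of_ne (hx j) (Ne.symm hj))⟩

/-- Perron's theorem: an entrywise positive matrix has a positive eigenvector. -/
lemma exists_pos_eigenvector {n : ℕ} [NeZero n] {P : Matrix (Fin n) (Fin n) ℝ}
    (hP : ∀ i j, 0 < P i j) :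
    ∃ (r : ℝ) (v : Fin n → ℝ), (∀ i, 0 < v i) ∧ P *ᵥ v = r • v := by
  set C : ℝ := ∑ i, ∑ j, P i j
  let K : Set (ℝ × (Fin n → ℝ)) :=
    (Set.Icc 0 C ×ˢ stdSimplex ℝ (Fin n)) ∩ {p | p.1 • p.2 ≤ P *ᵥ p.2}
  have hK : IsCompact K := by
    refine (isCompact_Icc.prod (isCompact_stdSimplex ℝ (Fin n))).inter_right
      (isClosed_le (by fun_prop) ?_)
    exact Continuous.matrix_mulVec continuous_const continuous_snd
  have hC : 0 ≤ C := Finset.sum_nonneg fun i _ => Finset.sum_nonneg fun j _ => (hP i j).le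
  have hne0 : ∀ x ∈ stdSimplex ℝ (Fin n), x ≠ 0 := by
    rintro x ⟨-, hx⟩ rfl
    simp at hx
  have hbound : ∀ (r : ℝ), ∀ x ∈ stdSimplex ℝ (Fin n), r • x ≤ P *ᵥ x → r ≤ C := by
    intro r x hx h
    have h1 : ∑ i, r * x i ≤ ∑ i, ∑ j, P i j * x j := Finset.sum_le_sum fun i _ => h i
    rw [← Finset.mul_sum, hx.2, mul_one] at h1
    refine h1.trans (Finset.sum_le_sum fun i _ => Finset.sum_le_sum fun j _ => ?_)
    have : x j ≤ 1 := hx.2 ▸ Finset.single_le_sum (fun k _ => hx.1 k) (Finset.mem_univ j)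
    nlinarith [hP i j]
  have hKne : K.Nonempty := by
    refine ⟨(0, Pi.single 0 1), ⟨⟨⟨le_rfl, hC⟩, single_mem_stdSimplex ℝ 0⟩, ?_⟩⟩
    have hx := single_mem_stdSimplex ℝ (0 : Fin n)
    intro i
    simpa using (mulVec_pos_of_pos hP hx.1 (hne0 _ hx) i).le
  obtain ⟨⟨r, v⟩, ⟨⟨hr, hv⟩, hle⟩, hmax⟩ := hK.exists_isMaxOn hKne continuous_fst.continuousOn
  simp only [Set.mem_ofPred_eq] at hr hv hle
  have hPv := mulVec_pos_of_pos hP hv.1 (hne0 v hv)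
  have heq : P *ᵥ v = r • v := by
    by_contra hne
    set y := P *ᵥ v with hy
    have hgt : ∀ i, 0 < (P *ᵥ y) i - r * y i := by
      intro i
      have := mulVec_pos_of_pos hP (sub_nonneg.2 hle) (sub_ne_zero.2 hne) i
      rwa [Matrix.mulVec_sub, Matrix.mulVec_smul, ← hy] at this
    obtain ⟨d, hd, hdle⟩ : ∃ d : ℝ, 0 < d ∧ ∀ i, d * y i ≤ (P *ᵥ y) i - r * y i := by
      obtain ⟨i₀, -, hi₀⟩ := Finset.exists_min_image Finset.univ
        (fun i => ((P *ᵥ y) i - r * y i) / y i) Finset.univ_nonempty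
      refine ⟨_, div_pos (hgt i₀) (hPv i₀), fun i => ?_⟩
      exact (le_div_iff₀ (hPv i)).1 (hi₀ i (Finset.mem_univ i))
    have hs : 0 < ∑ i, y i := Finset.sum_pos (fun i _ => hPv i) Finset.univ_nonempty
    set z : Fin n → ℝ := (∑ i, y i)⁻¹ • y with hz
    have hzmem : z ∈ stdSimplex ℝ (Fin n) := by
      refine ⟨fun i => mul_nonneg (inv_nonneg.2 hs.le) (hPv i).le, ?_⟩
      simp only [hz, Pi.smul_apply, smul_eq_mul, ← Finset.mul_sum]
      exact inv_mul_cancel₀ hs.ne'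
    have hzle : (r + d) • z ≤ P *ᵥ z := by
      rw [hz, Matrix.mulVec_smul, smul_comm]
      refine smul_le_smul_of_nonneg_left (fun i => ?_) (inv_nonneg.2 hs.le)
      have := hdle i
      simp only [Pi.smul_apply, smul_eq_mul]
      linarith
    have hmem : (r + d, z) ∈ K :=
      ⟨⟨⟨add_nonneg hr.1 hd.le, hbound _ _ hzmem hzle⟩, hzmem⟩, hzle⟩
    have := hmax hmem
    simp only [Set.mem_ofPred_eq] at this
    linarith
  refine ⟨r, v, fun i => ?_, heq⟩
  have h1 := hPv i
  rw [heq, Pi.smul_apply, smul_eq_mul] at h1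
  exact pos_of_mul_pos_right h1 hr.1

/-- A positive eigenvector of an entrywise positive matrix spans its eigenspace. -/
lemma eigenvector_eq_smul {n : ℕ} [NeZero n] {P : Matrix (Fin n) (Fin n) ℝ}
    (hP : ∀ i j, 0 < P i j) {r : ℝ} {v w : Fin n → ℝ} (hv : ∀ i, 0 < v i)
    (hPv : P *ᵥ v = r • v) (hPw : P *ᵥ w = r • w) : ∃ c : ℝ, w = c • v := by
  obtain ⟨i₀, -, hi₀⟩ := Finset.exists_min_image Finset.univ
    (fun i => w i / v i) Finset.univ_nonempty
  refine ⟨w i₀ / v i₀, sub_eq_zero.1 ?_⟩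
  by_contra hne
  have hnn : 0 ≤ w - (w i₀ / v i₀) • v := fun i => by
    have := (le_div_iff₀ (hv i)).1 (hi₀ i (Finset.mem_univ i))
    simpa using this
  have := mulVec_pos_of_pos hP hnn hne i₀
  rw [Matrix.mulVec_sub, Matrix.mulVec_smul, hPv, hPw] at this
  have h0 := (hv i₀).ne'
  simp only [Pi.sub_apply, Pi.smul_apply, smul_eq_mul] at this
  field_simp at this
  simp at this

/-- An algebraically positive matrix has a positive eigenvector. -/
lemma AlgPositive.exists_pos_eigenvector {n : ℕ} [NeZero n] {M : Matrix (Fin n) (Fin n) ℝ}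
    (h : AlgPositive M) : ∃ (c : ℝ) (v : Fin n → ℝ), (∀ i, 0 < v i) ∧ M *ᵥ v = c • v := by
  obtain ⟨f, hf⟩ := h
  obtain ⟨r, v, hv, hrv⟩ := _root_.exists_pos_eigenvector hf
  have hcomm : Polynomial.aeval M f * M = M * Polynomial.aeval M f := by
    simpa using congrArg (Polynomial.aeval M) (mul_comm f Polynomial.X)
  obtain ⟨c, hc⟩ := eigenvector_eq_smul hf hv hrv (w := M *ᵥ v) (by
    rw [Matrix.mulVec_mulVec, hcomm, ← Matrix.mulVec_mulVec, hrv, Matrix.mulVec_smul])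
  exact ⟨c, v, hv, hc⟩

/-- The eigenvalue equations of the perturbed cyclic matrix, whose row `0` is
`(3, 1, 0, …, 0)` and whose row `1` is `(-1, 0, 1, 0, …, 0)` up to an error `ε` on the cycle
entries, admit no positive solution `u`. -/
lemma cyclic_recurrence_no_pos_solution {n : ℕ} (hn : 3 ≤ n) {u : ℕ → ℝ} (hu : ∀ m, 0 < u m)
    (hper : u n = u 0) {ε c : ℝ} (hε : 0 < ε) (hε4 : ε ≤ 1 / 4) (hεn : 3 ^ n * ε < 1)
    (hfirst : ∃ t, |t| ≤ ε ∧ c * u 0 = 3 * u 0 + u 1 + t * u (n - 1))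
    (hrow : ∀ m, m + 1 < n → ∃ s t, |s| ≤ ε ∧ (m = 0 → t = -1) ∧ (m ≠ 0 → |t| ≤ ε) ∧
      c * u (m + 1) = t * u m + s * u (m + 1) + u (m + 2)) : False := by
  rcases le_or_gt (1 + 2 * ε) c with hc | hc
  · have h2 : u 0 + u 1 ≤ u 2 := by
      obtain ⟨s, t, hs, ht, -, h⟩ := hrow 0 (by omega)
      rw [ht rfl] at h
      have := abs_le.1 hs
      simp only [zero_add] at h
      nlinarith [hu 1]
    have hstep : ∀ m, m + 1 < n → u (m + 1) ≤ u (m + 2) := by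
      intro m
      induction m with
      | zero => intro _; simp only [zero_add]; linarith [hu 0]
      | succ m ih =>
        intro hm
        have h1 := ih (by omega)
        obtain ⟨s, t, hs, -, ht, h⟩ := hrow (m + 1) hm
        have hs := abs_le.1 hs
        have ht := abs_le.1 (ht (by omega))
        have e1 : 0 ≤ (c - s - 1 - ε) * u (m + 1 + 1) :=
          mul_nonneg (by linarith) (hu _).le
        have e2 : 0 ≤ (ε - t) * u (m + 1) := mul_nonneg (by linarith) (hu _).le
        have e3 : 0 ≤ ε * (u (m + 2) - u (m + 1)) := mul_nonneg hε.le (by linarith)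
        linarith
    have hmono : ∀ k, 2 + k ≤ n → u 2 ≤ u (2 + k) := by
      intro k
      induction k with
      | zero => intro _; rfl
      | succ k ih =>
        intro hk
        refine (ih (by omega)).trans ?_
        have := hstep (k + 1) (by omega)
        rwa [show k + 1 + 1 = 2 + k by ring, show k + 1 + 2 = 2 + (k + 1) by ring] at this
    have := hmono (n - 2) (by omega)
    rw [show 2 + (n - 2) = n by omega, hper] at this
    linarith [hu 1]
  · obtain ⟨t, ht, h⟩ := hfirst
    have ht := abs_le.1 ht
    have hN := hu (n - 1)
    have e1 : 0 ≤ (ε + t) * u (n - 1) := mul_nonneg (by linarith) hN.le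
    have e2 : 0 ≤ (2 - c) * u 0 := mul_nonneg (by linarith) (hu 0).le
    have h0 : u 0 ≤ ε * u (n - 1) := by linarith [hu 1]
    have h1 : u 1 ≤ ε * u (n - 1) := by linarith [hu 0]
    have hgrow : ∀ m, m + 1 ≤ n →
        u m ≤ 3 ^ m * (ε * u (n - 1)) ∧ u (m + 1) ≤ 3 ^ m * (ε * u (n - 1)) := by
      intro m
      induction m with
      | zero => intro _; simpa using ⟨h0, h1⟩
      | succ m ih =>
        intro hm
        obtain ⟨i1, i2⟩ := ih (by omega)
        obtain ⟨s, t, hs, ht0, ht, h⟩ := hrow m (by omega)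
        have hs := abs_le.1 hs
        have ht : -1 ≤ t := by
          rcases eq_or_ne m 0 with hm0 | hm0
          · exact (ht0 hm0).ge
          · linarith [(abs_le.1 (ht hm0)).1]
        have e3 : 0 ≤ (2 - c + s) * u (m + 1) := mul_nonneg (by linarith) (hu _).le
        have e4 : 0 ≤ (t + 1) * u m := mul_nonneg (by linarith) (hu _).le
        have e5 : 0 < u (m + 1) := hu _
        rw [pow_succ]
        constructor <;> rw [show m + 1 + 1 = m + 2 from rfl] at * <;> linarith
    have hlast := (hgrow (n - 1) (by omega)).1
    have hpow : (3 : ℝ) ^ (n - 1) ≤ 3 ^ n := pow_le_pow_right₀ (by norm_num) (by omega)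
    have : (3 : ℝ) ^ (n - 1) * ε < 1 := by nlinarith
    nlinarith

open Fin.CommRing in
/-- The normalised case: the positive cycle runs forward and the negative 2-cycle is `{0, 1}`. -/
lemma not_requiresAP_of_forward {n : ℕ} [NeZero n] (hn : 3 ≤ n)
    {A : Matrix (Fin n) (Fin n) SignType}
    (hzero : ∀ i j : Fin n, i ≠ j → j ≠ i + 1 → i ≠ j + 1 → A i j = 0)
    (hfwd : ∀ i, A i (i + 1) = 1) (hneg : A 1 0 = -1) (hdiag : A 0 0 = 1) :
    ¬ RequiresAP A := by
  intro hA
  have h1 : (1 : Fin n) ≠ 0 := by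
    intro h
    have := congrArg Fin.val h
    rw [Fin.val_one', Fin.val_zero, Nat.mod_eq_of_lt (by omega)] at this
    omega
  have h2 : (1 + 1 : Fin n) ≠ 0 := by
    intro h
    have := congrArg Fin.val h
    rw [Fin.val_add, Fin.val_one', Fin.val_zero, Nat.mod_eq_of_lt (a := 1) (by omega),
      Nat.mod_eq_of_lt (by omega)] at this
    omega
  set ε : ℝ := (1 / 4) ^ n with hε
  have hε0 : 0 < ε := by positivity
  have hε4 : ε ≤ 1 / 4 := pow_le_of_le_one (by norm_num) (by norm_num) (by omega)
  have hεn : 3 ^ n * ε < 1 := by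
    rw [hε, ← mul_pow]
    exact pow_lt_one₀ (by norm_num) (by norm_num) (by omega)
  let B : Matrix (Fin n) (Fin n) ℝ := fun i j =>
    (if i = 0 ∧ j = 0 then 3 else if j = i + 1 ∨ (i = 1 ∧ j = 0) then 1 else ε) * (A i j : ℝ)
  have hB : InQClass A B := by
    intro i j
    have hpos : 0 < (if i = 0 ∧ j = 0 then 3 else
        if j = i + 1 ∨ (i = 1 ∧ j = 0) then 1 else ε) := by
      split_ifs <;> first | assumption | norm_num
    simp only [B, sign_mul, sign_pos hpos, one_mul]
    cases A i j <;> simp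
  obtain ⟨c, v, hv, hcv⟩ := (hA B hB).exists_pos_eigenvector
  have hsmall : ∀ i j, ¬ (i = 0 ∧ j = 0) → ¬ (j = i + 1 ∨ (i = 1 ∧ j = 0)) → |B i j| ≤ ε := by
    intro i j hi hj
    simp only [B, if_neg hi, if_neg hj]
    cases A i j <;> simp [abs_of_pos hε0, hε0.le]
  have hrow : ∀ k : Fin n, c * v (k + 1) =
      B (k + 1) k * v k + B (k + 1) (k + 1) * v (k + 1) + v (k + 1 + 1) := by
    intro k
    have hk1 : k ≠ k + 1 := by simpa using h1
    have hk2 : k ≠ k + 1 + 1 := by simpa [add_assoc] using h2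
    have hk3 : k + 1 ≠ k + 1 + 1 := by simpa using h1
    have hone : B (k + 1) (k + 1 + 1) = 1 := by
      have : ¬ (k + 1 = 0 ∧ k + 1 + 1 = 0) := fun h => h1 (by simpa [h.1] using h.2)
      simp [B, this, hfwd]
    have h := congrFun hcv (k + 1)
    simp only [Matrix.mulVec, dotProduct, Pi.smul_apply, smul_eq_mul] at h
    rw [← h, ← Finset.sum_subset (Finset.subset_univ ({k, k + 1, k + 1 + 1} : Finset (Fin n)))]
    · rw [Finset.sum_insert (by simp [hk1, hk2]), Finset.sum_pair hk3, hone, one_mul, ← add_assoc (B (k + 1) k * v k)]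
    · intro j _ hj
      simp only [Finset.mem_insert, Finset.mem_singleton, not_or] at hj
      have : A (k + 1) j = 0 :=
        hzero _ _ (Ne.symm hj.2.1) hj.2.2 fun h => hj.1 (add_right_cancel h).symm
      simp [B, this]
  refine cyclic_recurrence_no_pos_solution hn (u := fun m => v (m : Fin n)) (fun m => hv _)
    (by simp) hε0 hε4 hεn (c := c) ?_ ?_
  · have hlast : ((n - 1 : ℕ) : Fin n) + 1 = 0 := by
      rw [← Nat.cast_succ, Nat.succ_eq_add_one, Nat.sub_add_cancel (by omega), Fin.natCast_self]
    have h := hrow ((n - 1 : ℕ) : Fin n)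
    have hB0 : B 0 0 = 3 := by simp [B, hdiag]
    rw [hlast, hB0, zero_add] at h
    refine ⟨B 0 ((n - 1 : ℕ) : Fin n), hsmall _ _ ?_ ?_, ?_⟩
    · rintro ⟨-, h⟩
      rw [h, zero_add] at hlast
      exact h1 hlast
    · rintro (h | h)
      · rw [h, zero_add] at hlast
        exact h2 hlast
      · exact h1 h.1.symm
    · simp only [Nat.cast_zero, Nat.cast_one]
      linarith
  · intro m hm
    have hcast : ∀ a : ℕ, a < n → (a : Fin n) = 0 → a = 0 := fun a ha h => by
      have := congrArg Fin.val h
      rwa [Fin.val_natCast, Nat.mod_eq_of_lt ha, Fin.val_zero] at this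
    have hm1 : (m : Fin n) + 1 ≠ 0 := fun h => by
      have := hcast (m + 1) hm (by exact_mod_cast h)
      omega
    refine ⟨B (m + 1) (m + 1), B (m + 1) m, hsmall _ _ (fun h => hm1 h.1) ?_, ?_, ?_, ?_⟩
    · rintro (h | h)
      · exact h1 (by simpa using h)
      · exact hm1 h.2
    · rintro rfl
      simp [B, hneg, h1]
    · intro hm0
      refine hsmall _ _ (fun h => hm1 h.1) ?_
      rintro (h | h)
      · exact h2 (by simpa [add_assoc] using h)
      · exact hm0 (hcast m (by omega) h.2)
    · have h := hrow m
      have e : ((m + 2 : ℕ) : Fin n) = m + 1 + 1 := by push_cast; ring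
      simp only [e, Nat.cast_succ]
      exact h

open Fin.CommRing in
/-- If `A` is cycle-form, `D(A_+)` contains a directed `n`-cycle and
there are `i ≠ j` with `sign(a_{ij} a_{ji}) = -` and `a_{ii} = +`, then `A` does not
require algebraic positivity. -/
theorem stmt_8 {n : ℕ} [NeZero n] (hn : 3 ≤ n) (A : Matrix (Fin n) (Fin n) SignType)
    (hcyc : CycleForm A) (hplus : PlusNCycle A)
    (h : ∃ i j : Fin n, i ≠ j ∧ A i j * A j i = -1 ∧ A i i = 1) :
    ¬ RequiresAP A := by
  obtain ⟨i, j, hij, hprod, hii⟩ := h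
  intro hA
  have hz := hcyc.1
  by_cases hj : j = i + 1
  · subst hj
    rcases hplus with hp | hp
    · rw [hp, one_mul] at hprod
      refine not_requiresAP_of_forward hn ?_ ?_ ?_ ?_ (hA.submatrix (Equiv.addLeft i))
      · intro a b h1 h2 h3
        exact hz _ _ (by simpa using h1) (by simpa [add_assoc] using h2)
          (by simpa [add_assoc] using h3)
      · intro a
        simpa [add_assoc] using hp (i + a)
      · simpa using hprod
      · simpa using hii
    · rw [hp, mul_one] at hprod
      refine not_requiresAP_of_forward hn ?_ ?_ ?_ ?_ (hA.transpose.submatrix (Equiv.addLeft i))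
      · intro a b h1 h2 h3
        exact hz _ _ (by simpa using h1.symm) (by simpa [add_assoc] using h3)
          (by simpa [add_assoc] using h2)
      · intro a
        simpa [add_assoc] using hp (i + a)
      · simpa using hprod
      · simpa using hii
  · by_cases hi : i = j + 1
    · have hji : j = i - 1 := eq_sub_of_add_eq hi.symm
      have hsub : ∀ a b : Fin n, i - a = i - b + 1 ↔ b = a + 1 := fun a b => by
        constructor <;> intro h <;> linear_combination h
      have hshift : ∀ a : Fin n, i - (a + 1) + 1 = i - a := fun a => by ring
      rcases hplus with hp | hp
      · rw [hi, hp, mul_one] at hprod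
        refine not_requiresAP_of_forward hn ?_ ?_ ?_ ?_
          (hA.transpose.submatrix (Equiv.subLeft i))
        · intro a b h1 h2 h3
          exact hz _ _ (by simpa using h1.symm) (by simpa [hsub] using h2)
            (by simpa [hsub] using h3)
        · intro a
          simpa [hshift] using hp (i - (a + 1))
        · simpa [← hji, ← hi] using hprod
        · simpa using hii
      · rw [hi, hp, one_mul] at hprod
        refine not_requiresAP_of_forward hn ?_ ?_ ?_ ?_ (hA.submatrix (Equiv.subLeft i))
        · intro a b h1 h2 h3
          exact hz _ _ (by simpa using h1) (by simpa [hsub] using h3)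
            (by simpa [hsub] using h2)
        · intro a
          simpa [hshift] using hp (i - (a + 1))
        · simpa [← hji, ← hi] using hprod
        · simpa using hii
    · rw [hz i j hij hj hi, zero_mul] at hprod
      exact absurd hprod (by decide)
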